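/- Let R be an associative ring, S a set of finitely presentable right R-modules, m ≥ 0 an integer, C an ℵ_m-presentable right R-module that is a directed colimit of modules from S, and D a right R-module with Ext^i_R(S,D) = 0 for all S ∈ S and all i > 0. Then Ext^i_R(C,D) = 0 for all i > m. -/

import Mathlib

open CategoryTheory Limits Opposite

universe u

/-- A module is finitely presentable if it is the cokernel of a morphism of finitely
generated free modules. -/
def IsFinitelyPresentableMod (A : Type u) [Ring A] (M : Type u) [AddCommGroup M]
    [Module A M] : Prop :=
  ∃ (k l : ℕ) (f : (Fin k →₀ A) →ₗ[A] (Fin l →₀ A)),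
    Nonempty (M ≃ₗ[A] ((Fin l →₀ A) ⧸ LinearMap.range f))

/-- A right `R`-module is `ℵ_m`-presentable if it is the cokernel of a morphism of free
right `R`-modules each with fewer than `ℵ_m` generators. -/
def AlephPresentableMod (m : ℕ) (R : Type u) [Ring R] (F : Type u) [AddCommGroup F]
    [Module Rᵐᵒᵖ F] : Prop :=
  ∃ (ι σ : Type u) (_ : Cardinal.mk ι < Cardinal.aleph m) (_ : Cardinal.mk σ < Cardinal.aleph m)
    (f : (ι →₀ Rᵐᵒᵖ) →ₗ[Rᵐᵒᵖ] (σ →₀ Rᵐᵒᵖ)),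
    Nonempty (F ≃ₗ[Rᵐᵒᵖ] ((σ →₀ Rᵐᵒᵖ) ⧸ LinearMap.range f))

theorem ext_iff_abelianExt {A : Type u} [Ring A] (M D : ModuleCat.{u} A) (n : ℕ) :
    Subsingleton (((Ext ℤ (ModuleCat.{u} A) (n+1)).obj (op M)).obj D) ↔
      Subsingleton (Abelian.Ext.{u} M D (n+1)) := by
  let P := projectiveResolution M
  have h1 : Subsingleton (((Ext ℤ (ModuleCat.{u} A) (n+1)).obj (op M)).obj D) ↔
      ∀ f : P.complex.X (n+1) ⟶ D, P.complex.d (n+2) (n+1) ≫ f = 0 →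
        ∃ g : P.complex.X n ⟶ D, P.complex.d (n+1) n ≫ g = f := by
    rw [← ModuleCat.isZero_iff_subsingleton, (P.isoExt (R := ℤ) (n+1) D).isZero_iff,
      ← HomologicalComplex.exactAt_iff_isZero_homology,
      HomologicalComplex.exactAt_iff' _ n (n+1) (n+2) (by simp) (by simp),
      ShortComplex.moduleCat_exact_iff]
    exact Iff.rfl
  have h2 : Subsingleton (Abelian.Ext.{u} M D (n+1)) ↔ 
      ∀ f : P.complex.X (n+1) ⟶ D, P.complex.d (n+2) (n+1) ≫ f = 0 →
        ∃ g : P.complex.X n ⟶ D, P.complex.d (n+1) n ≫ g = f := by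
    constructor
    · intro h f hf
      exact (P.extMk_eq_zero_iff f (n+2) rfl hf n rfl).1 (Subsingleton.elim _ _)
    · intro h
      refine subsingleton_of_forall_eq 0 fun α => ?_
      obtain ⟨f, hf, rfl⟩ := P.extMk_surjective α (n+2) rfl
      exact (P.extMk_eq_zero_iff f (n+2) rfl hf n rfl).2 (h f hf)
  rw [h1, h2]

/-- cosyzygy -/
noncomputable def cosyz {A : Type u} [Ring A] (D : ModuleCat.{u} A) : ModuleCat.{u} A :=
  cokernel (Injective.ι D)

noncomputable def cosyzSeq {A : Type u} [Ring A] (D : ModuleCat.{u} A) :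
    ShortComplex (ModuleCat.{u} A) :=
  ShortComplex.mk (Injective.ι D) (cokernel.π (Injective.ι D)) (cokernel.condition _)

theorem cosyzSeq_shortExact {A : Type u} [Ring A] (D : ModuleCat.{u} A) :
    (cosyzSeq D).ShortExact where
  exact := ShortComplex.exact_cokernel _
  mono_f := inferInstanceAs (Mono (Injective.ι D))
  epi_g := inferInstanceAs (Epi (cokernel.π (Injective.ι D)))

theorem ext_cosyz {A : Type u} [Ring A] (M D : ModuleCat.{u} A) (n : ℕ) :
    Subsingleton (Abelian.Ext.{u} M D (n+2)) ↔ Subsingleton (Abelian.Ext.{u} M (cosyz D) (n+1)) := by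
  have hS := cosyzSeq_shortExact D
  have : Injective (cosyzSeq D).X₂ := inferInstanceAs (Injective (Injective.under D))
  constructor
  · intro h
    refine subsingleton_of_forall_eq 0 fun α => ?_
    obtain ⟨x, hx⟩ := Abelian.Ext.covariant_sequence_exact₃ M hS (n₀ := n+1) α (n₁ := n+2) rfl
      (@Subsingleton.elim _ h _ _)
    rw [Abelian.Ext.eq_zero_of_injective x, Abelian.Ext.zero_comp] at hx
    exact hx.symm
  · intro h
    refine subsingleton_of_forall_eq 0 fun α => ?_
    obtain ⟨x, hx⟩ := Abelian.Ext.covariant_sequence_exact₁ M hS α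
      (Abelian.Ext.eq_zero_of_injective _) (n₀ := n+1) rfl
    have hx0 : x = 0 := @Subsingleton.elim _ h _ _
    rw [hx0, Abelian.Ext.zero_comp] at hx
    exact hx.symm

theorem ext_one_iff {A : Type u} [Ring A] {P : Type u} [AddCommGroup P] [Module A P]
    [Module.Projective A P] {M D : ModuleCat.{u} A} (p : P →ₗ[A] M) (hp : Function.Surjective p) :
    Subsingleton (Abelian.Ext.{u} M D 1) ↔
      ∀ f : LinearMap.ker p →ₗ[A] D, ∃ g : P →ₗ[A] D, ∀ x : LinearMap.ker p, g x = f x := by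
  have hS := LinearMap.shortExact_shortComplexKer hp
  have : Projective (p.shortComplexKer).X₂ :=
    ModuleCat.projective_of_categoryTheory_projective (ModuleCat.of A P)
  constructor
  · intro h f
    obtain ⟨x, hx⟩ := Abelian.Ext.contravariant_sequence_exact₁ hS D
      (Abelian.Ext.mk₀ (ModuleCat.ofHom f)) (n₁ := 1) rfl (@Subsingleton.elim _ h _ _)
    obtain ⟨g, rfl⟩ := Abelian.Ext.addEquiv₀.symm.surjective x
    have hx' : Abelian.Ext.mk₀ (p.shortComplexKer.f ≫ g) = Abelian.Ext.mk₀ (ModuleCat.ofHom f) := by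
      rw [← hx, ← Abelian.Ext.mk₀_comp_mk₀]
      rfl
    have h3 := (Abelian.Ext.mk₀_bijective _ _).1 hx'
    refine ⟨g.hom, fun x => ?_⟩
    exact congrArg (fun k => k.hom x) h3
  · intro h
    refine subsingleton_of_forall_eq 0 fun α => ?_
    obtain ⟨x, hx⟩ := Abelian.Ext.contravariant_sequence_exact₃ hS D α
      (Abelian.Ext.eq_zero_of_projective _) (n₀ := 0) rfl
    obtain ⟨f, rfl⟩ := (Abelian.Ext.mk₀_bijective _ _).2 x
    obtain ⟨g, hg⟩ := h f.hom
    have hf : f = p.shortComplexKer.f ≫ (ModuleCat.ofHom g : ModuleCat.of A P ⟶ D) := by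
      ext x
      exact (hg x).symm
    rw [← hx, hf, ← Abelian.Ext.mk₀_comp_mk₀]
    exact hS.extClass_comp_assoc _

theorem ext_iff_iterate {A : Type u} [Ring A] (M D : ModuleCat.{u} A) (n : ℕ) :
    Subsingleton (((Ext ℤ (ModuleCat.{u} A) (n+1)).obj (op M)).obj D) ↔
      Subsingleton (Abelian.Ext.{u} M (cosyz^[n] D) 1) := by
  rw [ext_iff_abelianExt]
  induction n generalizing D with
  | zero => rfl
  | succ n ih => rw [ext_cosyz, ih, Function.iterate_succ_apply]

/-- Extension property of injective modules. -/
def InjExt (A : Type u) [Ring A] (I : Type u) [AddCommGroup I] [Module A I] : Prop :=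
  ∀ (F : Type u) [AddCommGroup F] [Module A F] (K : Submodule A F) (f : K →ₗ[A] I),
    ∃ g : F →ₗ[A] I, ∀ x : K, g x = f x

theorem cosyz_data {A : Type u} [Ring A] (D : ModuleCat.{u} A) :
    ∃ (I : ModuleCat.{u} A) (j : D →ₗ[A] I) (q : I →ₗ[A] cosyz D), InjExt A I ∧
      Function.Injective j ∧ Function.Surjective q ∧ LinearMap.ker q = LinearMap.range j := by
  have hS := cosyzSeq_shortExact D
  refine ⟨Injective.under D, (cosyzSeq D).f.hom, (cosyzSeq D).g.hom, ?_, ?_, ?_, ?_⟩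
  · intro F _ _ K f
    have : Mono (ModuleCat.ofHom K.subtype) :=
      (ModuleCat.mono_iff_injective _).2 K.injective_subtype
    let f' : ModuleCat.of A K ⟶ Injective.under D := ModuleCat.ofHom f
    refine ⟨(Injective.factorThru f' (ModuleCat.ofHom K.subtype)).hom, fun x => ?_⟩
    exact congrArg (fun k => k.hom x) (Injective.comp_factorThru f' (ModuleCat.ofHom K.subtype))
  · exact hS.moduleCat_injective_f
  · exact hS.moduleCat_surjective_g
  · exact hS.exact.moduleCat_range_eq_ker.symm


theorem transfinite_glue {W K V : Type*} [LinearOrder W] [WellFoundedLT W] [Inhabited V]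
    (N : W → Set K) (P : W → (K → V) → Prop)
    (hP : ∀ a g g', (∀ k ∈ N a, g k = g' k) → P a g → P a g')
    (hext : ∀ a g, (∀ b < a, P b g) → ∃ g', P a g' ∧ ∀ b < a, ∀ k ∈ N b, g' k = g k) :
    ∃ g, ∀ a, P a g := by
  classical
  let base : (a : W) → (∀ b, b < a → (K → V)) → (K → V) := fun a ih k =>
    if h : ∃ b, ∃ _ : b < a, k ∈ N b then ih h.choose h.choose_spec.choose k else default
  let step : (a : W) → (∀ b, b < a → (K → V)) → (K → V) := fun a ih =>
    if h : ∃ g', P a g' ∧ ∀ b < a, ∀ k ∈ N b, g' k = base a ih k then h.choose else default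
  let G : W → (K → V) := (wellFounded_lt (α := W)).fix step
  have hG : ∀ a, G a = step a (fun b _ => G b) := fun a => WellFounded.fix_eq _ _ _
  have key : ∀ a, P a (G a) ∧ ∀ b < a, ∀ k ∈ N b, G a k = G b k := by
    intro a
    induction a using WellFoundedLT.induction with
    | ind a ih =>
      have hbase : ∀ b < a, ∀ k ∈ N b, base a (fun b _ => G b) k = G b k := by
        intro b hb k hk
        have h : ∃ b, ∃ _ : b < a, k ∈ N b := ⟨b, hb, hk⟩
        have e : base a (fun b _ => G b) k = G h.choose k := dif_pos h
        rw [e]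
        have h1 : h.choose < a := h.choose_spec.choose
        have h2 : k ∈ N h.choose := h.choose_spec.choose_spec
        rcases lt_trichotomy h.choose b with h3 | h3 | h3
        · exact ((ih b hb).2 _ h3 k h2).symm
        · rw [h3]
        · exact (ih _ h1).2 b h3 k hk
      have hex := hext a (base a (fun b _ => G b)) (fun b hb =>
        hP b (G b) _ (fun k hk => (hbase b hb k hk).symm) (ih b hb).1)
      have e : G a = hex.choose := by
        rw [hG]; exact dif_pos hex
      rw [e]
      refine ⟨hex.choose_spec.1, fun b hb k hk => ?_⟩
      rw [hex.choose_spec.2 b hb k hk, hbase b hb k hk]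
  refine ⟨fun k => if h : ∃ b, k ∈ N b then G h.choose k else default, fun a => ?_⟩
  refine hP a (G a) _ (fun k hk => ?_) (key a).1
  have h : ∃ b, k ∈ N b := ⟨a, hk⟩
  rw [dif_pos h]
  rcases lt_trichotomy h.choose a with h3 | h3 | h3
  · exact (key a).2 _ h3 k h.choose_spec
  · rw [h3]
  · exact ((key _).2 a h3 k hk).symm

theorem mk_finset_lt {T : Type u} {c : Cardinal.{u}} (hc : Cardinal.aleph0 ≤ c)
    (hT : Cardinal.mk T < c) : Cardinal.mk (Finset T) < c := by
  rcases finite_or_infinite T with h | h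
  · exact (Cardinal.mk_lt_aleph0).trans_le hc
  · rwa [Cardinal.mk_finset_of_infinite]

theorem exists_directed_hull {X : Type u} [Preorder X] {Y : Set X} (hY : DirectedOn (· ≤ ·) Y)
    (hne : Y.Nonempty) {c : Cardinal.{u}} (hc : Cardinal.aleph0 ≤ c) {T : Set X} (hTY : T ⊆ Y)
    (hT : Cardinal.mk T < c) :
    ∃ U : Set X, T ⊆ U ∧ U ⊆ Y ∧ DirectedOn (· ≤ ·) U ∧ Cardinal.mk U < c := by
  classical
  have hb : ∀ s : Finset Y, ∃ z : Y, ∀ i ∈ s, i ≤ z := by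
    have := hne.to_subtype
    exact fun s => (directedOn_iff_directed.1 hY).finset_le s
  choose b hb using hb
  let inc : T → Y := fun t => ⟨t.1, hTY t.2⟩
  let step : (s : Finset T) → (∀ t, t ⊂ s → Y) → Y := fun s ih =>
    b (s.image inc ∪ s.ssubsets.attach.image (fun t => ih t.1 (Finset.mem_ssubsets.1 t.2)))
  let h : Finset T → Y := Finset.strongInduction (p := fun _ => Y) step
  have hh : ∀ s, h s = step s (fun t _ => h t) := fun s =>
    Finset.strongInduction_eq (p := fun _ => Y) step s
  have h1 : ∀ s, ∀ t ∈ s, inc t ≤ h s := by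
    intro s t ht
    rw [hh]
    exact hb _ _ (Finset.mem_union_left _ (Finset.mem_image_of_mem _ ht))
  have h2 : ∀ s t, t ⊂ s → h t ≤ h s := by
    intro s t ht
    rw [hh s]
    exact hb _ _ (Finset.mem_union_right _ (Finset.mem_image.2
      ⟨⟨t, Finset.mem_ssubsets.2 ht⟩, Finset.mem_attach _ _, rfl⟩))
  have h3 : ∀ s t, t ⊆ s → h t ≤ h s := by
    intro s t ht
    rcases ht.eq_or_ssubset with rfl | ht
    · exact le_rfl
    · exact h2 s t ht
  refine ⟨T ∪ Set.range (fun s => (h s).1), Set.subset_union_left, ?_, ?_, ?_⟩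
  · rintro x (hx | ⟨s, rfl⟩)
    · exact hTY hx
    · exact (h s).2
  · have h4 : ∀ x ∈ T ∪ Set.range (fun s => (h s).1), ∃ s, x ≤ (h s).1 := by
      rintro x (hx | ⟨s, rfl⟩)
      · exact ⟨{⟨x, hx⟩}, h1 {⟨x, hx⟩} ⟨x, hx⟩ (by simp)⟩
      · exact ⟨s, le_rfl⟩
    intro x hx y hy
    obtain ⟨s, hs⟩ := h4 x hx
    obtain ⟨t, ht⟩ := h4 y hy
    refine ⟨(h (s ∪ t)).1, Or.inr ⟨_, rfl⟩, hs.trans ?_, ht.trans ?_⟩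
    · exact h3 _ _ Finset.subset_union_left
    · exact h3 _ _ Finset.subset_union_right
  · refine (Cardinal.mk_union_le _ _).trans_lt (Cardinal.add_lt_of_lt hc hT ?_)
    exact Cardinal.mk_range_le.trans_lt (mk_finset_lt hc hT)

theorem exists_directed_chain {X : Type u} [Preorder X] {Y : Set X} (hY : DirectedOn (· ≤ ·) Y)
    {c : Cardinal.{u}} (hc : c.IsRegular) (hYc : Cardinal.mk Y ≤ c) :
    ∃ (W : Type u) (_ : LinearOrder W) (_ : WellFoundedLT W) (Z : W → Set X),
      Monotone Z ∧ (⋃ a, Z a) = Y ∧ (∀ a, DirectedOn (· ≤ ·) (Z a)) ∧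
      (∀ a, Cardinal.mk (Z a) < c) ∧ ∀ a, Cardinal.mk (⋃ b : Set.Iio a, Z b.1) < c := by
  classical
  let W := (Cardinal.mk Y).ord.ToType
  have e : Nonempty (W ≃ Y) := Cardinal.eq.1 (Cardinal.mk_ord_toType _)
  obtain ⟨e⟩ := e
  let Good : Set X → Set X → Prop := fun T U =>
    T ⊆ U ∧ U ⊆ Y ∧ DirectedOn (· ≤ ·) U ∧ Cardinal.mk U < c
  let step : (a : W) → (∀ b, b < a → Set X) → Set X := fun a ih =>
    let T : Set X := {(e a).1} ∪ ⋃ b : Set.Iio a, ih b.1 b.2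
    if h : ∃ U, Good T U then h.choose else ∅
  let Z : W → Set X := (wellFounded_lt (α := W)).fix step
  have hZ : ∀ a, Z a = step a (fun b _ => Z b) := fun a => WellFounded.fix_eq _ _ _
  have hIio : ∀ a : W, Cardinal.mk (Set.Iio a) < c := fun a =>
    (Cardinal.mk_Iio_toType_ord_lt a).trans_le hYc
  have key : ∀ a, Good ({(e a).1} ∪ ⋃ b : Set.Iio a, Z b.1) (Z a) := by
    intro a
    induction a using WellFoundedLT.induction with
    | ind a ih =>
      have hex : ∃ U, Good ({(e a).1} ∪ ⋃ b : Set.Iio a, Z b.1) U := by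
        refine exists_directed_hull hY ⟨_, (e a).2⟩ hc.aleph0_le ?_ ?_
        · refine Set.union_subset (by simp) (Set.iUnion_subset fun b => (ih b.1 b.2).2.1)
        · refine (Cardinal.mk_union_le _ _).trans_lt (Cardinal.add_lt_of_lt hc.aleph0_le ?_ ?_)
          · rw [Cardinal.mk_singleton]
            exact Cardinal.one_lt_aleph0.trans_le hc.aleph0_le
          · exact (Cardinal.card_iUnion_lt_iff_forall_of_isRegular hc (hIio a)).2
              fun b => (ih b.1 b.2).2.2.2
      have e1 : Z a = hex.choose := by
        rw [hZ]; exact dif_pos hex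
      rw [e1]
      exact hex.choose_spec
  refine ⟨W, inferInstance, inferInstance, Z, ?_, ?_, fun a => (key a).2.2.1,
    fun a => (key a).2.2.2, fun a => ?_⟩
  · intro a b hab
    rcases hab.eq_or_lt with rfl | hab
    · exact le_rfl
    · exact (Set.subset_union_of_subset_right
        (Set.subset_iUnion (fun b : Set.Iio b => Z b.1) ⟨a, hab⟩) _).trans (key b).1
  · refine Set.Subset.antisymm (Set.iUnion_subset fun a => (key a).2.1) fun y hy => ?_
    refine Set.mem_iUnion.2 ⟨e.symm ⟨y, hy⟩, (key _).1 (Or.inl ?_)⟩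
    simp
  · exact (Cardinal.card_iUnion_lt_iff_forall_of_isRegular hc (hIio a)).2
      fun b => (key b.1).2.2.2

section core
variable {A : Type u} [Ring A] {X : Type u} [Preorder X] {G : X → Type u}
  [∀ x, AddCommGroup (G x)] [∀ x, Module A (G x)] (φ : ∀ x y, x ≤ y → G x →ₗ[A] G y)

open Classical in
/-- Evaluation of the free module on all elements at the index `y`. -/
noncomputable def evAt (y : X) : ((Σ x, G x) →₀ A) →ₗ[A] G y :=
  Finsupp.linearCombination A (fun p : Σ x, G x => if h : p.1 ≤ y then φ p.1 y h p.2 else 0)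

theorem evAt_mono (hφ : ∀ x y z (h : x ≤ y) (h' : y ≤ z) g,
      φ y z h' (φ x y h g) = φ x z (h.trans h') g)
    {y z : X} (hyz : y ≤ z) (v : (Σ x, G x) →₀ A) (hv : ∀ p ∈ v.support, p.1 ≤ y) :
    evAt φ z v = φ y z hyz (evAt φ y v) := by
  simp only [evAt, Finsupp.linearCombination_apply, Finsupp.sum, map_sum, map_smul]
  refine Finset.sum_congr rfl fun p hp => ?_
  rw [dif_pos (hv p hp), dif_pos ((hv p hp).trans hyz), hφ]

/-- The relations witnessed inside `Y`. -/
def KK (Y : Set X) : Set ((Σ x, G x) →₀ A) :=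
  {v | ∃ y ∈ Y, (∀ p ∈ v.support, p.1 ∈ Y ∧ p.1 ≤ y) ∧ evAt φ y v = 0}

/-- The submodule of relations witnessed inside `Y`. -/
noncomputable def KS (Y : Set X) : Submodule A ((Σ x, G x) →₀ A) := Submodule.span A (KK φ Y)

theorem KK_mono {Y Z : Set X} (h : Y ⊆ Z) : KK φ Y ⊆ KK φ Z := by
  rintro v ⟨y, hy, h1, h2⟩
  exact ⟨y, h hy, fun p hp => ⟨h (h1 p hp).1, (h1 p hp).2⟩, h2⟩

theorem KS_mono {Y Z : Set X} (h : Y ⊆ Z) : KS φ Y ≤ KS φ Z := Submodule.span_mono (KK_mono φ h)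

theorem mem_KS_iff (hφ : ∀ x y z (h : x ≤ y) (h' : y ≤ z) g,
      φ y z h' (φ x y h g) = φ x z (h.trans h') g)
    {Y : Set X} (hY : DirectedOn (· ≤ ·) Y) (hne : Y.Nonempty) (v : (Σ x, G x) →₀ A) :
    v ∈ KS φ Y ↔ v ∈ KK φ Y := by
  classical
  refine ⟨fun h => ?_, fun h => Submodule.subset_span h⟩
  induction h using Submodule.span_induction with
  | mem v hv => exact hv
  | zero => 
    obtain ⟨y, hy⟩ := hne
    exact ⟨y, hy, by simp, by simp⟩
  | add v w _ _ hv hw =>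
    obtain ⟨y, hy, h1, h2⟩ := hv
    obtain ⟨z, hz, h3, h4⟩ := hw
    obtain ⟨t, ht, hyt, hzt⟩ := hY y hy z hz
    refine ⟨t, ht, fun p hp => ?_, ?_⟩
    · rcases Finset.mem_union.1 (Finsupp.support_add hp) with hp | hp
      · exact ⟨(h1 p hp).1, (h1 p hp).2.trans hyt⟩
      · exact ⟨(h3 p hp).1, (h3 p hp).2.trans hzt⟩
    · rw [map_add, evAt_mono φ hφ hyt v (fun p hp => (h1 p hp).2),
        evAt_mono φ hφ hzt w (fun p hp => (h3 p hp).2), h2, h4]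
      simp
  | smul a v _ hv =>
    obtain ⟨y, hy, h1, h2⟩ := hv
    refine ⟨y, hy, fun p hp => h1 p (Finsupp.support_smul hp), ?_⟩
    rw [map_smul, h2, smul_zero]

theorem KS_iUnion {ι : Type*} (Z : ι → Set X) (hZ : Directed (· ⊆ ·) Z) :
    KS φ (⋃ i, Z i) = ⨆ i, KS φ (Z i) := by
  classical
  apply le_antisymm
  · refine Submodule.span_le.2 ?_
    rintro v ⟨y, hy, h1, h2⟩
    obtain ⟨i0, hi0⟩ := Set.mem_iUnion.1 hy
    have : Nonempty ι := ⟨i0⟩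
    obtain ⟨i, hi⟩ := hZ.exists_mem_subset_of_finset_subset_biUnion
      (s := insert y (v.support.image Sigma.fst)) (by
        intro x hx
        simp only [Finset.coe_insert, Set.mem_insert_iff, Finset.mem_coe, Finset.mem_image] at hx
        rcases hx with rfl | ⟨p, hp, rfl⟩
        · exact hy
        · exact (h1 p hp).1)
    refine Submodule.mem_iSup_of_mem i (Submodule.subset_span ⟨y, hi (by simp), fun p hp =>
      ⟨hi ?_, (h1 p hp).2⟩, h2⟩)
    simp only [Finset.coe_insert, Set.mem_insert_iff, Finset.mem_coe]
    exact Or.inr (Finset.mem_image_of_mem _ hp)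
  · exact iSup_le fun i => KS_mono φ (Set.subset_iUnion _ _)

/-- Vanishing of the first Ext of the colimit over `Y`. -/
def ExtOn (Y : Set X) (E : Type u) [AddCommGroup E] [Module A E] : Prop :=
  ∀ f : KS φ Y →ₗ[A] E, ∃ g : ((Σ x, G x) →₀ A) →ₗ[A] E, ∀ v : KS φ Y, g v = f v

theorem linear_glue {F I : Type u} [AddCommGroup F] [Module A F] [AddCommGroup I] [Module A I]
    (hI : InjExt A I) {ι : Type*} (N : ι → Submodule A F) (hN : Directed (· ≤ ·) N) (g : F → I)
    (hg : ∀ i, ∃ l : F →ₗ[A] I, ∀ v ∈ N i, g v = l v) :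
    ∃ l : F →ₗ[A] I, ∀ i, ∀ v ∈ N i, l v = g v := by
  rcases isEmpty_or_nonempty ι with h | h
  · exact ⟨0, fun i => isEmptyElim i⟩
  · have hmem : ∀ v, v ∈ (⨆ i, N i) ↔ ∃ i, v ∈ N i := fun v => Submodule.mem_iSup_of_directed N hN
    let l : (⨆ i, N i : Submodule A F) →ₗ[A] I :=
      { toFun := fun v => g v
        map_add' := by
          rintro ⟨v, hv⟩ ⟨w, hw⟩
          obtain ⟨i, hi⟩ := (hmem v).1 hv
          obtain ⟨j, hj⟩ := (hmem w).1 hw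
          obtain ⟨k, hik, hjk⟩ := hN i j
          obtain ⟨l, hl⟩ := hg k
          change g (v + w) = g v + g w
          rw [hl _ (hik hi), hl _ (hjk hj), hl _ (add_mem (hik hi) (hjk hj)), map_add]
        map_smul' := by
          rintro a ⟨v, hv⟩
          obtain ⟨i, hi⟩ := (hmem v).1 hv
          obtain ⟨l, hl⟩ := hg i
          change g (a • v) = a • g v
          rw [hl _ hi, hl _ (Submodule.smul_mem _ _ hi), map_smul] }
    obtain ⟨l', hl'⟩ := hI F _ l
    exact ⟨l', fun i v hv => hl' ⟨v, (hmem v).2 ⟨i, hv⟩⟩⟩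

theorem extOn_step {D I Q : Type u} [AddCommGroup D] [Module A D] [AddCommGroup I] [Module A I]
    [AddCommGroup Q] [Module A Q] (j : D →ₗ[A] I) (q : I →ₗ[A] Q) (hI : InjExt A I)
    (hj : Function.Injective j) (hq : Function.Surjective q)
    (hqj : LinearMap.ker q = LinearMap.range j)
    {W : Type u} [LinearOrder W] [WellFoundedLT W] (Z : W → Set X) (hZ : Monotone Z)
    (h1 : ∀ a, ExtOn φ (Z a) Q) (h2 : ∀ a, ExtOn φ (⋃ b : Set.Iio a, Z b.1) D) :
    ExtOn φ (⋃ a, Z a) Q := by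
  intro f
  have : Inhabited I := ⟨0⟩
  let Y := ⋃ a, Z a
  have hsub : ∀ a, KS φ (Z a) ≤ KS φ Y := fun a => KS_mono φ (Set.subset_iUnion _ _)
  have hmono : ∀ a b, a ≤ b → KS φ (Z a) ≤ KS φ (Z b) := fun a b h => KS_mono φ (hZ h)
  let P : W → (((Σ x, G x) →₀ A) → I) → Prop := fun a g =>
    ∃ l : ((Σ x, G x) →₀ A) →ₗ[A] I, ∀ v, ∀ hv : v ∈ KS φ (Z a),
      g v = l v ∧ q (l v) = f ⟨v, hsub a hv⟩
  obtain ⟨g, hg⟩ : ∃ g, ∀ a, P a g := by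
    refine transfinite_glue (fun a => (KS φ (Z a) : Set _)) P ?_ ?_
    · rintro a g g' hgg ⟨l, hl⟩
      exact ⟨l, fun v hv => ⟨(hgg v hv).symm.trans (hl v hv).1, (hl v hv).2⟩⟩
    · intro a g hg
      obtain ⟨s, hs⟩ := linear_glue hI (fun b : Set.Iio a => KS φ (Z b.1))
        (directed_of_isDirected_le fun b b' h => hmono b.1 b'.1 h) g (fun b => by
          obtain ⟨l, hl⟩ := hg b.1 b.2
          exact ⟨l, fun v hv => (hl v hv).1⟩)
      obtain ⟨f', hf'⟩ := h1 a (f.comp (Submodule.inclusion (hsub a)))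
      obtain ⟨t, ht⟩ := Module.projective_lifting_property q f' hq
      have ht' : ∀ v (hv : v ∈ KS φ (Z a)), q (t v) = f ⟨v, hsub a hv⟩ := by
        intro v hv
        have := hf' ⟨v, hv⟩
        rw [← ht] at this
        exact this
      have hle : KS φ (⋃ b : Set.Iio a, Z b.1) ≤ LinearMap.ker (q.comp (t - s)) := by
        rw [KS_iUnion φ (fun b : Set.Iio a => Z b.1)
          (directed_of_isDirected_le fun b b' h => hZ h)]
        refine iSup_le fun b v hv => ?_
        obtain ⟨l, hl⟩ := hg b.1 b.2
        rw [LinearMap.mem_ker, LinearMap.comp_apply, LinearMap.sub_apply, map_sub,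
          ht' v (hmono b.1 a (le_of_lt b.2) hv), hs b v hv, (hl v hv).1, (hl v hv).2, sub_self]
      let d0 : KS φ (⋃ b : Set.Iio a, Z b.1) →ₗ[A] LinearMap.range j :=
        LinearMap.codRestrict _ ((t - s).domRestrict _) (fun v => by
          rw [← hqj]; exact hle v.2)
      obtain ⟨d, hd⟩ := h2 a ((LinearEquiv.ofInjective j hj).symm.toLinearMap.comp d0)
      have hd' : ∀ v ∈ KS φ (⋃ b : Set.Iio a, Z b.1), j (d v) = t v - s v := by
        intro v hv
        have e1 : d v = (LinearEquiv.ofInjective j hj).symm (d0 ⟨v, hv⟩) := hd ⟨v, hv⟩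
        rw [e1]
        exact congrArg Subtype.val ((LinearEquiv.ofInjective j hj).apply_symm_apply (d0 ⟨v, hv⟩))
      have hqj' : ∀ x, q (j x) = 0 := fun x => by
        rw [← LinearMap.mem_ker, hqj]; exact ⟨x, rfl⟩
      refine ⟨t - j.comp d, ⟨t - j.comp d, fun v hv => ⟨rfl, ?_⟩⟩, fun b hb v hv => ?_⟩
      · simp [hqj', ht' v hv]
      · have : v ∈ KS φ (⋃ b : Set.Iio a, Z b.1) :=
          KS_mono φ (Set.subset_iUnion (fun b : Set.Iio a => Z b.1) ⟨b, hb⟩) hv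
        change t v - j (d v) = g v
        rw [hd' v this, hs ⟨b, hb⟩ v hv]
        abel
  obtain ⟨l, hl⟩ := linear_glue hI (fun b => KS φ (Z b))
    (directed_of_isDirected_le hmono) g (fun b => by
      obtain ⟨l, hl⟩ := hg b
      exact ⟨l, fun v hv => (hl v hv).1⟩)
  refine ⟨q.comp l, ?_⟩
  have hle : KS φ Y ≤ Submodule.map (KS φ Y).subtype
      (LinearMap.ker ((q.comp l).comp (KS φ Y).subtype - f)) := by
    conv_lhs => rw [KS_iUnion φ Z (directed_of_isDirected_le hZ)]
    refine iSup_le fun b v hv => ⟨⟨v, hsub b hv⟩, ?_, rfl⟩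
    obtain ⟨l', hl'⟩ := hg b
    have := hl' v hv
    simp only [SetLike.mem_coe, LinearMap.mem_ker, LinearMap.sub_apply, LinearMap.comp_apply,
      Submodule.subtype_apply]
    rw [hl b v hv, this.1, this.2, sub_self]
  intro v
  obtain ⟨w, hw, hwv⟩ := hle v.2
  obtain rfl : w = v := Subtype.ext hwv
  have := LinearMap.mem_ker.1 hw
  rw [LinearMap.sub_apply, sub_eq_zero] at this
  exact this

theorem extOn_base (hφ0 : ∀ x g, φ x x le_rfl g = g)
    (hφ : ∀ x y z (h : x ≤ y) (h' : y ≤ z) g,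
      φ y z h' (φ x y h g) = φ x z (h.trans h') g) {E : ModuleCat.{u} A}
    (hE : ∀ x, Subsingleton (Abelian.Ext.{u} (ModuleCat.of A (G x)) E 1))
    {Y : Set X} (hY : DirectedOn (· ≤ ·) Y) (hfin : Y.Finite) : ExtOn φ Y E := by
  classical
  intro f
  rcases Y.eq_empty_or_nonempty with rfl | hne
  · refine ⟨0, fun v => ?_⟩
    have hv : v = 0 := by
      apply Subtype.ext
      have e : KS φ (∅ : Set X) = ⊥ := by
        rw [KS, Submodule.span_eq_bot]
        rintro v ⟨y, hy, _⟩
        exact hy.elim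
      exact (Submodule.mem_bot A).1 (e ▸ v.2)
    rw [hv]; simp
  obtain ⟨m, hm, hmax⟩ : ∃ m ∈ Y, ∀ y ∈ Y, y ≤ m := by
    have := hne.to_subtype
    obtain ⟨z, hz⟩ := (directedOn_iff_directed.1 hY).finset_le
      (hfin.to_subtype |> fun h => (@Fintype.ofFinite Y h) |> fun h => @Finset.univ Y h)
    exact ⟨z.1, z.2, fun y hy => hz ⟨y, hy⟩ (by simp)⟩
  let r : ((Σ x, G x) →₀ A) →ₗ[A] ((Σ x, G x) →₀ A) :=
    (Submodule.subtype _).comp (Finsupp.restrictDom A A {p : Σ x, G x | p.1 ∈ Y})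
  have hr : ∀ v, r v = Finsupp.filter (· ∈ {p : Σ x, G x | p.1 ∈ Y}) v := fun v => rfl
  have hrsupp : ∀ v, ∀ p ∈ (r v).support, p.1 ∈ Y := by
    intro v p hp
    rw [hr, Finsupp.support_filter, Finset.mem_filter] at hp
    exact hp.2
  have hrid : ∀ v ∈ KK φ Y, r v = v := by
    rintro v ⟨y, hy, h1, h2⟩
    rw [hr, Finsupp.filter_eq_self_iff]
    intro p hp
    exact (h1 p (Finsupp.mem_support_iff.2 hp)).1
  let p : ((Σ x, G x) →₀ A) →ₗ[A] ModuleCat.of A (G m) := (evAt φ m).comp r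
  have hp : Function.Surjective p := by
    intro g
    refine ⟨Finsupp.single ⟨m, g⟩ 1, ?_⟩
    change evAt φ m (r (Finsupp.single ⟨m, g⟩ 1)) = g
    rw [hr, Finsupp.filter_single_of_pos _ (by exact hm)]
    simp [evAt, hφ0]
  have hker : ∀ v : LinearMap.ker p, r v ∈ KS φ Y := fun v =>
    Submodule.subset_span ⟨m, hm, fun x hx => ⟨hrsupp v x hx, hmax _ (hrsupp v x hx)⟩, v.2⟩
  obtain ⟨g, hg⟩ := (ext_one_iff p hp).1 (hE m)
    (f.comp ((r.domRestrict (LinearMap.ker p)).codRestrict (KS φ Y) hker))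
  refine ⟨g, fun v => ?_⟩
  have hv := (mem_KS_iff φ hφ hY hne v.1).1 v.2
  have hvr := hrid v hv
  obtain ⟨y, hy, h1, h2⟩ := hv
  have hvk : (v : (Σ x, G x) →₀ A) ∈ LinearMap.ker p := by
    change evAt φ m (r v) = 0
    rw [hvr, evAt_mono φ hφ (hmax y hy) v (fun p hp => (h1 p hp).2), h2, map_zero]
  rw [hg ⟨v, hvk⟩, LinearMap.comp_apply]
  congr 1
  exact Subtype.ext hvr

theorem extOn_main (hφ0 : ∀ x g, φ x x le_rfl g = g)
    (hφ : ∀ x y z (h : x ≤ y) (h' : y ≤ z) g,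
      φ y z h' (φ x y h g) = φ x z (h.trans h') g) (D : ModuleCat.{u} A)
    (hE : ∀ (n : ℕ) x, Subsingleton (Abelian.Ext.{u} (ModuleCat.of A (G x)) (cosyz^[n] D) 1))
    (m : ℕ) : ∀ (Y : Set X), DirectedOn (· ≤ ·) Y → Cardinal.mk Y < Cardinal.aleph m →
      ∀ i : ℕ, m ≤ i → ExtOn φ Y (cosyz^[i] D : ModuleCat.{u} A) := by
  induction m with
  | zero =>
    intro Y hY hc i _
    refine extOn_base φ hφ0 hφ (hE i) hY ?_
    simpa using hc
  | succ m ih =>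
    intro Y hY hc i hi
    obtain ⟨k, rfl⟩ : ∃ k, i = k + 1 := ⟨i - 1, by omega⟩
    have hreg : (Cardinal.aleph (m : Ordinal.{u})).IsRegular := by
      cases m with
      | zero => simpa using Cardinal.isRegular_aleph0
      | succ m => 
        push_cast
        exact Cardinal.isRegular_aleph_add_one _
    have hc' : Cardinal.mk Y ≤ Cardinal.aleph (m : Ordinal.{u}) := by
      push_cast at hc
      rw [Cardinal.aleph_add_one] at hc
      exact Order.lt_succ_iff.1 hc
    obtain ⟨W, _, _, Z, hZ, hU, hdir, hcard, hcard'⟩ := exists_directed_chain hY hreg hc'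
    obtain ⟨I, j, q, hI, hj, hq, hqj⟩ := cosyz_data (cosyz^[k] D)
    have := extOn_step φ j q hI hj hq hqj Z hZ ?_ ?_
    · rw [hU] at this
      rw [Function.iterate_succ_apply']
      exact this
    · intro a
      have := ih (Z a) (hdir a) (hcard a) (k+1) (by omega)
      rw [Function.iterate_succ_apply'] at this
      exact this
    · intro a
      refine ih _ ?_ (hcard' a) k (by omega)
      exact Set.directedOn_iUnion (directed_of_isDirected_le fun b b' h => hZ h) fun b => hdir b.1

theorem ext_final [IsDirected X (· ≤ ·)] [Nonempty X]
    {c : Cardinal.{u}} (hc : Cardinal.aleph0 ≤ c) {C E : ModuleCat.{u} A}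
    (hφ : ∀ x y z (h : x ≤ y) (h' : y ≤ z) g,
      φ y z h' (φ x y h g) = φ x z (h.trans h') g)
    (γ : ∀ x, G x →ₗ[A] C) (hγ : ∀ x y h g, γ y (φ x y h g) = γ x g)
    (hsurj : ∀ z : C, ∃ x g, γ x g = z)
    (hzero : ∀ x g, γ x g = 0 → ∃ y, ∃ h : x ≤ y, φ x y h g = 0)
    {ι σ : Type u} (hι : Cardinal.mk ι < c) (hσ : Cardinal.mk σ < c)
    (rel : (ι →₀ A) →ₗ[A] (σ →₀ A)) (π : (σ →₀ A) →ₗ[A] C) (hπ : Function.Surjective π)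
    (hker : LinearMap.ker π = LinearMap.range rel)
    (hE : ∀ Y : Set X, DirectedOn (· ≤ ·) Y → Cardinal.mk Y < c → ExtOn φ Y E) :
    Subsingleton (Abelian.Ext.{u} C E 1) := by
  classical
  rw [ext_one_iff π hπ]
  intro f
  let cF : ((Σ x, G x) →₀ A) →ₗ[A] C := Finsupp.linearCombination A (fun p => γ p.1 p.2)
  have hcF : ∀ v y, (∀ p ∈ v.support, p.1 ≤ y) → cF v = γ y (evAt φ y v) := by
    intro v y hv
    simp only [cF, evAt, Finsupp.linearCombination_apply, Finsupp.sum, map_sum, map_smul]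
    refine Finset.sum_congr rfl fun p hp => ?_
    rw [dif_pos (hv p hp), hγ]
  have hkill : ∀ v, cF v = 0 → ∃ y, (∀ p ∈ v.support, p.1 ≤ y) ∧ evAt φ y v = 0 := by
    intro v hv
    obtain ⟨y, hy⟩ := Finset.exists_le (v.support.image Sigma.fst)
    have hy' : ∀ p ∈ v.support, p.1 ≤ y := fun p hp => hy _ (Finset.mem_image_of_mem _ hp)
    rw [hcF v y hy'] at hv
    obtain ⟨z, hyz, hz⟩ := hzero _ _ hv
    exact ⟨z, fun p hp => (hy' p hp).trans hyz, by rw [evAt_mono φ hφ hyz v hy', hz]⟩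
  choose ξ g hg using fun s : σ => hsurj (π (Finsupp.single s 1))
  let θ : (σ →₀ A) →ₗ[A] ((Σ x, G x) →₀ A) :=
    Finsupp.linearCombination A (fun s => Finsupp.single (⟨ξ s, g s⟩ : Σ x, G x) (1 : A))
  have hθ : ∀ w, cF (θ w) = π w := by
    intro w
    have : cF.comp θ = π := by
      ext s
      simp [cF, θ, hg]
    exact LinearMap.congr_fun this w
  have hθs : ∀ w, ∀ p ∈ (θ w).support, p.1 ∈ Set.range ξ := by
    intro w
    have hw : θ w ∈ Finsupp.supported A A {p : Σ x, G x | p.1 ∈ Set.range ξ} := by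
      simp only [θ, Finsupp.linearCombination_apply, Finsupp.sum]
      refine Submodule.sum_mem _ fun s _ => Submodule.smul_mem _ _ ?_
      exact Finsupp.single_mem_supported A _ ⟨s, rfl⟩
    intro p hp
    exact (Finsupp.mem_supported A _).1 hw hp
  have hrel : ∀ i : ι, cF (θ (rel (Finsupp.single i 1))) = 0 := by
    intro i
    rw [hθ, ← LinearMap.mem_ker, hker]
    exact ⟨_, rfl⟩
  choose y hy1 hy2 using fun i => hkill _ (hrel i)
  obtain ⟨Y, hTY, -, hYdir, hYc⟩ := exists_directed_hull (X := X) (Y := Set.univ)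
    (fun a _ b _ => by
      obtain ⟨z, h1, h2⟩ := directed_of (· ≤ ·) a b
      exact ⟨z, trivial, h1, h2⟩) Set.univ_nonempty hc
    (T := Set.range ξ ∪ Set.range y) (Set.subset_univ _)
    ((Cardinal.mk_union_le _ _).trans_lt (Cardinal.add_lt_of_lt hc
      (Cardinal.mk_range_le.trans_lt hσ) (Cardinal.mk_range_le.trans_lt hι)))
  have hθK : ∀ w ∈ LinearMap.ker π, θ w ∈ KS φ Y := by
    intro w hw
    rw [hker] at hw
    obtain ⟨x, rfl⟩ := hw
    induction x using Finsupp.induction_linear with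
    | zero => simp
    | add a b ha hb => rw [map_add, map_add]; exact add_mem ha hb
    | single i a =>
      have : (Finsupp.single i a : ι →₀ A) = a • Finsupp.single i 1 := by simp
      rw [this, map_smul, map_smul]
      refine Submodule.smul_mem _ _ (Submodule.subset_span ⟨y i, hTY (Or.inr ⟨i, rfl⟩), ?_, hy2 i⟩)
      exact fun p hp => ⟨hTY (Or.inl (hθs _ p hp)), hy1 i p hp⟩
  obtain ⟨ψ, hψ⟩ := Module.projective_lifting_property π cF hπ
  have hψ' : ∀ v, π (ψ v) = cF v := fun v => LinearMap.congr_fun hψ v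
  have hψK : ∀ v : KS φ Y, ψ v ∈ LinearMap.ker π := by
    have : KS φ Y ≤ LinearMap.ker cF := by
      refine Submodule.span_le.2 ?_
      rintro v ⟨y, hy, h1, h2⟩
      change cF v = 0
      rw [hcF v y (fun p hp => (h1 p hp).2), h2, map_zero]
    intro v
    rw [LinearMap.mem_ker, hψ']
    exact this v.2
  obtain ⟨h, hh⟩ := hE Y hYdir hYc
    (f.comp ((ψ.domRestrict (KS φ Y)).codRestrict (LinearMap.ker π) hψK))
  let δ : (σ →₀ A) →ₗ[A] LinearMap.ker π :=
    (ψ.comp θ - LinearMap.id).codRestrict (LinearMap.ker π) (fun w => by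
      rw [LinearMap.mem_ker, LinearMap.sub_apply, map_sub, LinearMap.comp_apply, hψ', hθ]
      simp)
  refine ⟨h.comp θ - f.comp δ, fun w => ?_⟩
  rw [LinearMap.sub_apply, LinearMap.comp_apply, LinearMap.comp_apply, hh ⟨_, hθK w w.2⟩,
    LinearMap.comp_apply, ← map_sub]
  congr 1
  apply Subtype.ext
  change ψ (θ w) - (ψ (θ w) - (w : σ →₀ A)) = w
  abel

end core

/-- **Ext vanishing for `ℵ_m`-presentable directed colimits.**
Let `R` be an associative ring, `S` a set of finitely presentable right `R`-modules,
`m ≥ 0` an integer, `C` an `ℵ_m`-presentable right `R`-module which is a directed colimit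
of modules from `S`, and `D` a right `R`-module such that `Ext^i_R(T,D) = 0` for all
`T ∈ S` and all `i > 0`.  Then `Ext^i_R(C,D) = 0` for all `i > m`.
(Right `R`-modules are modules over `Rᵐᵒᵖ`; Ext groups are taken in the abelian category
of right `R`-modules.) -/
theorem ext_vanishing_of_aleph_presentable_directed_colimit
    (R : Type u) [Ring R] (S : Set (ModuleCat.{u} Rᵐᵒᵖ))
    (hS : ∀ T ∈ S, IsFinitelyPresentableMod Rᵐᵒᵖ T)
    (m : ℕ) (C : ModuleCat.{u} Rᵐᵒᵖ)
    (hC : AlephPresentableMod m R C)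
    (Ξ : Type u) [PartialOrder Ξ] [IsDirected Ξ (· ≤ ·)] [Nonempty Ξ]
    (G : Ξ ⥤ ModuleCat.{u} Rᵐᵒᵖ) (hG : ∀ ξ : Ξ, G.obj ξ ∈ S)
    (c : Cocone G) (hc : IsColimit c) (hCc : Nonempty (c.pt ≅ C))
    (D : ModuleCat.{u} Rᵐᵒᵖ)
    (hD : ∀ T ∈ S, ∀ i : ℕ, 0 < i →
      Subsingleton (((Ext ℤ (ModuleCat.{u} Rᵐᵒᵖ) i).obj (op T)).obj D)) :
    ∀ i : ℕ, m < i →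
      Subsingleton (((Ext ℤ (ModuleCat.{u} Rᵐᵒᵖ) i).obj (op C)).obj D) := by
  intro i hi
  obtain ⟨k, rfl⟩ : ∃ k, i = k + 1 := ⟨i - 1, by omega⟩
  rw [ext_iff_iterate]
  obtain ⟨ι, σ, hι, hσ, rel, ⟨e⟩⟩ := hC
  obtain ⟨iso⟩ := hCc
  let φ : ∀ x y : Ξ, x ≤ y → G.obj x →ₗ[Rᵐᵒᵖ] G.obj y := fun x y h => (G.map (homOfLE h)).hom
  have hφ0 : ∀ x g, φ x x le_rfl g = g := by
    intro x g
    have : G.map (homOfLE (le_refl x)) = 𝟙 _ := G.map_id x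
    change (G.map (homOfLE (le_refl x))).hom g = g
    rw [this]; rfl
  have hφ : ∀ x y z (h : x ≤ y) (h' : y ≤ z) g,
      φ y z h' (φ x y h g) = φ x z (h.trans h') g := by
    intro x y z h h' g
    have : G.map (homOfLE (h.trans h')) = G.map (homOfLE h) ≫ G.map (homOfLE h') := by
      rw [← G.map_comp]; rfl
    change _ = (G.map (homOfLE (h.trans h'))).hom g
    rw [this]; rfl
  let γ : ∀ x : Ξ, G.obj x →ₗ[Rᵐᵒᵖ] C := fun x => (c.ι.app x ≫ iso.hom).hom
  have hisoinj : Function.Injective iso.hom.hom := (ModuleCat.mono_iff_injective iso.hom).1 inferInstance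
  have hisosurj : Function.Surjective iso.hom.hom :=
    (ModuleCat.epi_iff_surjective iso.hom).1 inferInstance
  let π : (σ →₀ Rᵐᵒᵖ) →ₗ[Rᵐᵒᵖ] C := e.symm.toLinearMap.comp (Submodule.mkQ _)
  refine ext_final φ (Cardinal.aleph0_le_aleph (m : Ordinal.{u})) hφ γ ?_ ?_ ?_ hι hσ rel π ?_ ?_ ?_
  · intro x y h g
    change (G.map (homOfLE h) ≫ c.ι.app y ≫ iso.hom).hom g = _
    rw [c.w_assoc]
  · intro z
    obtain ⟨w, rfl⟩ := hisosurj z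
    obtain ⟨x, g, hg⟩ := Concrete.isColimit_exists_rep G hc w
    exact ⟨x, g, congrArg iso.hom.hom hg⟩
  · intro x g hg
    have h0 : (c.ι.app x).hom g = (c.ι.app x).hom 0 := by
      apply hisoinj
      rw [map_zero, map_zero]
      exact hg
    obtain ⟨y, f, f', hff⟩ := Concrete.isColimit_exists_of_rep_eq G hc g 0 h0
    refine ⟨y, leOfHom f, ?_⟩
    have : (G.map f).hom g = (G.map f').hom 0 := hff
    rw [map_zero] at this
    exact this
  · exact e.symm.surjective.comp (Submodule.mkQ_surjective _)
  · ext w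
    simp [π]
  · intro Y hY hYc
    refine extOn_main φ hφ0 hφ D ?_ m Y hY hYc k (by omega)
    intro n x
    have := (ext_iff_iterate (G.obj x) D n).1 (hD _ (hG x) (n+1) (by omega))
    exact this
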